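/- arXiv:1308.5057 — 4 statements merged into one kernel-verified Lean document; each statement's English description precedes it below -/
import Mathlib

section
/- There is a constant C' (independent of N and ε_N) such that, writing ξ^{(N,0)} = (x^{(N)}, y, (z₀,0,…,0)): (i) |H_N(ξ^{(N,0)}, u, v^{(N)})| ≤ C'(1 + |u|² + (1/N)|v^{(N)}|²) for all x^{(N)}, y, z₀, u, v^{(N)}; (ii) for all ξ^{(N)} = (x^{(N)}, y, z^{(N)}) and ξ̃^{(N)} = (x̃^{(N)}, ỹ, z̃^{(N)}), |H_N(ξ^{(N)}, u, v^{(N)}) − H_N(ξ̃^{(N)}, u, v^{(N)})| ≤ C'(1 + |u| + ε_N Σ_{ℓ=1}^N |v_ℓ|) · (|x₀ − x̃₀| + |y − ỹ| + |z₀ − z̃₀| + (1/N) Σ_{ℓ=1}^N (|x_ℓ − x̃_ℓ| + |z_ℓ − z̃_ℓ|)) + C' ε_N Σ_{ℓ=1}^N |v_ℓ| |x_ℓ − x̃_ℓ|. -/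
open scoped RealInnerProductSpace BigOperators
open MeasureTheory

noncomputable section

/-- Euclidean space `ℝ^n`. -/
abbrev EVec (n : ℕ) : Type := EuclideanSpace ℝ (Fin n)

/-- The Hamiltonian `H_N` of the game with `N` minor agents.  The index `0` of the
vectors `x, z : Fin (N+1) → ℝ` corresponds to the major player, the indices
`ℓ.succ`, `ℓ : Fin N`, to the minor agents. -/
def HN {k m : ℕ} (f : ℝ × ℝ × ℝ × ℝ × ℝ → EVec k → EVec m → ℝ)
    (b0 : ℝ → ℝ → ℝ → EVec k) (b1 : ℝ → ℝ → ℝ → EVec m)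
    (N : ℕ) (ε : ℝ) (x : Fin (N + 1) → ℝ) (y : ℝ) (z : Fin (N + 1) → ℝ)
    (u : EVec k) (v : Fin N → EVec m) : ℝ :=
  (1 / (N : ℝ)) * ∑ ℓ : Fin N, f (x 0, x ℓ.succ, y, z 0, z ℓ.succ) u (v ℓ)
    + ⟪(1 / (N : ℝ)) • ∑ ℓ : Fin N, b0 (x 0) (x ℓ.succ) (z 0), u⟫ * z 0
    + ε * ∑ i : Fin N,
        ((1 / (N : ℝ)) * ∑ ℓ : Fin N, ⟪b1 (x 0) (x ℓ.succ) (z i.succ), v ℓ⟫) * z i.succ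

/-- Mean value inequality along the segment from the origin, for a gradient bounded on a ball. -/
theorem abs_sub_zero_le_of_hasGradientAt {n : ℕ} {g : EVec n → ℝ} {G : EVec n → EVec n}
    (hg : ∀ x, HasGradientAt g (G x) x) {a : EVec n} {M : ℝ}
    (hM : ∀ x, ‖x‖ ≤ ‖a‖ → ‖G x‖ ≤ M) : |g a - g 0| ≤ M * ‖a‖ := by
  have h := (convex_closedBall (0 : EVec n) ‖a‖).norm_image_sub_le_of_norm_hasFDerivWithin_le
    (f := g) (C := M) (x := 0) (y := a)
    (fun x _ => (hg x).hasFDerivAt.hasFDerivWithinAt)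
    (fun x hx => by simpa using hM x (by simpa using hx)) (by simp) (by simp)
  simpa using h

/-- A function whose partial gradients have linear growth has quadratic growth. -/
theorem abs_le_of_hasGradientAt_of_linear_growth {k m : ℕ} {g : EVec k → EVec m → ℝ}
    {Gu : EVec k → EVec m → EVec k} {Gv : EVec k → EVec m → EVec m} {C mu : ℝ}
    (hC : 0 ≤ C) (hmu : 0 ≤ mu)
    (hGu : ∀ v u, HasGradientAt (fun u' => g u' v) (Gu u v) u)
    (hGv : ∀ u v, HasGradientAt (fun v' => g u v') (Gv u v) v)
    (h0 : |g 0 0| ≤ C) (hu : ∀ u, ‖Gu u 0‖ ≤ C + C * ‖u‖)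
    (hv : ∀ u v, ‖Gv u v‖ ≤ C + C * ‖v‖ + mu * ‖u‖) (u : EVec k) (v : EVec m) :
    |g u v| ≤ (3 * C + mu) * (1 + ‖u‖ ^ 2 + ‖v‖ ^ 2) := by
  have h1 : |g u 0 - g 0 0| ≤ (C + C * ‖u‖) * ‖u‖ :=
    abs_sub_zero_le_of_hasGradientAt (hGu 0) fun x hx => (hu x).trans (by gcongr)
  have h2 : |g u v - g u 0| ≤ (C + C * ‖v‖ + mu * ‖u‖) * ‖v‖ :=
    abs_sub_zero_le_of_hasGradientAt (hGv u) fun x hx => (hv u x).trans (by gcongr)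
  have h3 : |g u v| ≤ |g u v - g u 0| + |g u 0 - g 0 0| + |g 0 0| := by
    have := abs_add_three (g u v - g u 0) (g u 0 - g 0 0) (g 0 0)
    simpa using this
  nlinarith [mul_nonneg hC (sq_nonneg (‖u‖ - 1)), mul_nonneg hC (sq_nonneg (‖v‖ - 1)),
    mul_nonneg hmu (sq_nonneg (‖u‖ - ‖v‖)), mul_nonneg hC (sq_nonneg ‖u‖),
    mul_nonneg hC (sq_nonneg ‖v‖), mul_nonneg hmu (sq_nonneg ‖u‖),
    mul_nonneg hmu (sq_nonneg ‖v‖)]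

/-- The sup norm on `ℝ⁵` is dominated by the `ℓ¹` norm. -/
theorem norm_prod_five_le (a b c d e : ℝ) :
    ‖(a, b, c, d, e)‖ ≤ |a| + |b| + |c| + |d| + |e| := by
  simp only [Prod.norm_def, Real.norm_eq_abs]
  have := abs_nonneg a
  have := abs_nonneg b
  have := abs_nonneg c
  have := abs_nonneg d
  have := abs_nonneg e
  simp only [sup_le_iff]
  refine ⟨?_, ?_, ?_, ?_, ?_⟩ <;> linarith

/-- Adding a constant to every term of a nonempty family adds it to the mean. -/
theorem mean_const_add {N : ℕ} (hN : 1 ≤ N) (c : ℝ) (g : Fin N → ℝ) :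
    (1 / (N : ℝ)) * ∑ ℓ, (c + g ℓ) = c + (1 / (N : ℝ)) * ∑ ℓ, g ℓ := by
  have : (N : ℝ) ≠ 0 := by positivity
  rw [Finset.sum_add_distrib]
  simp only [Finset.sum_const, Finset.card_univ, Fintype.card_fin, nsmul_eq_mul]
  field_simp

theorem abs_mean_le {N : ℕ} {g h : Fin N → ℝ} (H : ∀ ℓ, |g ℓ| ≤ h ℓ) :
    |(1 / (N : ℝ)) * ∑ ℓ, g ℓ| ≤ (1 / (N : ℝ)) * ∑ ℓ, h ℓ := by
  rw [abs_mul, abs_of_nonneg (by positivity : (0 : ℝ) ≤ 1 / N)]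
  gcongr
  exact (Finset.abs_sum_le_sum_abs _ _).trans (Finset.sum_le_sum fun ℓ _ => H ℓ)

theorem inner_mean_mul_eq {k N : ℕ} (b : Fin N → EVec k) (u : EVec k) (t : ℝ) :
    ⟪(1 / (N : ℝ)) • ∑ ℓ, b ℓ, u⟫ * t = (1 / (N : ℝ)) * ∑ ℓ, ⟪t • b ℓ, u⟫ := by
  simp only [real_inner_smul_left, sum_inner, Finset.mul_sum, Finset.sum_mul]
  exact Finset.sum_congr rfl fun _ _ => by ring

theorem mean_inner_mul_eq {m N : ℕ} (b v : Fin N → EVec m) (t : ℝ) :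
    ((1 / (N : ℝ)) * ∑ ℓ, ⟪b ℓ, v ℓ⟫) * t = (1 / (N : ℝ)) * ∑ ℓ, ⟪t • b ℓ, v ℓ⟫ := by
  simp only [real_inner_smul_left, Finset.mul_sum, Finset.sum_mul]
  exact Finset.sum_congr rfl fun _ _ => by ring

theorem abs_inner_sub_inner_le {n : ℕ} {a a' w : EVec n} {L : ℝ} (h : ‖a - a'‖ ≤ L) :
    |⟪a, w⟫ - ⟪a', w⟫| ≤ L * ‖w‖ := by
  rw [← inner_sub_left]
  exact (abs_real_inner_le_norm _ _).trans (by gcongr)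

/-- Quadratic growth at `ξ^{(N,0)}` and a Lipschitz-type estimate for the
Hamiltonian `H_N`, with a constant independent of `N` and `ε_N`. -/
theorem HN_growth_and_lipschitz
    (k m : ℕ) (hk : 1 ≤ k) (hm : 1 ≤ m)
    (C lam mu : ℝ) (hC : 0 < C) (hmu : 0 < mu) (hmulam : mu < lam)
    (f : ℝ × ℝ × ℝ × ℝ × ℝ → EVec k → EVec m → ℝ)
    (Du : ℝ × ℝ × ℝ × ℝ × ℝ → EVec k → EVec m → EVec k)
    (Dv : ℝ × ℝ × ℝ × ℝ × ℝ → EVec k → EVec m → EVec m)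
    (hf_cont : Continuous fun p : (ℝ × ℝ × ℝ × ℝ × ℝ) × EVec k × EVec m => f p.1 p.2.1 p.2.2)
    (hDu : ∀ ξ v u, HasGradientAt (fun u' => f ξ u' v) (Du ξ u v) u)
    (hDv : ∀ ξ u v, HasGradientAt (fun v' => f ξ u v') (Dv ξ u v) v)
    (hD_cont : ∀ ξ, Continuous fun p : EVec k × EVec m => (Du ξ p.1 p.2, Dv ξ p.1 p.2))
    (hAiu : ∀ ξ u u' v, ⟪Du ξ u v - Du ξ u' v, u - u'⟫ ≤ -lam * ‖u - u'‖ ^ 2)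
    (hAiv : ∀ ξ u v v', ⟪Dv ξ u v - Dv ξ u v', v - v'⟫ ≥ lam * ‖v - v'‖ ^ 2)
    (hAii1 : ∀ ξ, |f ξ 0 0| ≤ C)
    (hAii2 : ∀ ξ ξ' u v, |f ξ u v - f ξ' u v| ≤ C * ‖ξ - ξ'‖)
    (hAii3 : ∀ ξ ξ' u u' v v',
      ‖Du ξ u v - Du ξ' u' v'‖ ≤ C * (‖ξ - ξ'‖ + ‖u - u'‖) + mu * ‖v - v'‖)
    (hAii4 : ∀ ξ, ‖Du ξ 0 0‖ ≤ C)
    (hAii5 : ∀ (ξ ξ' : ℝ × ℝ × ℝ × ℝ × ℝ) u u' v v',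
      ‖Dv ξ u v - Dv ξ' u' v'‖ ≤
        C * (‖(ξ.1, ξ.2.1, ξ.2.2.1, ξ.2.2.2.1) - (ξ'.1, ξ'.2.1, ξ'.2.2.1, ξ'.2.2.2.1)‖ +
          ‖v - v'‖) + mu * ‖u - u'‖)
    (hAii6 : ∀ ξ, ‖Dv ξ 0 0‖ ≤ C)
    (b0 : ℝ → ℝ → ℝ → EVec k) (b1 : ℝ → ℝ → ℝ → EVec m)
    (Cb : ℝ) (hCbpos : 0 < Cb)
    (hb0cont : Continuous fun p : ℝ × ℝ × ℝ => b0 p.1 p.2.1 p.2.2)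
    (hb1cont : Continuous fun p : ℝ × ℝ × ℝ => b1 p.1 p.2.1 p.2.2)
    (hb0bdd : ∀ x0 x1 z, ‖b0 x0 x1 z‖ ≤ Cb)
    (hb1bdd : ∀ x0 x1 z, ‖b1 x0 x1 z‖ ≤ Cb)
    (hb0zbdd : ∀ x0 x1 z, ‖z • b0 x0 x1 z‖ ≤ Cb)
    (hb1zbdd : ∀ x0 x1 z, ‖z • b1 x0 x1 z‖ ≤ Cb)
    (hb0zlip : ∀ x0 x1 z x0' x1' z',
      ‖z • b0 x0 x1 z - z' • b0 x0' x1' z'‖ ≤ Cb * (|x0 - x0'| + |x1 - x1'| + |z - z'|))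
    (hb1zlip : ∀ x0 x1 z x0' x1' z',
      ‖z • b1 x0 x1 z - z' • b1 x0' x1' z'‖ ≤ Cb * (|x0 - x0'| + |x1 - x1'| + |z - z'|))
    :
    ∃ C' : ℝ, 0 < C' ∧ ∀ N : ℕ, 1 ≤ N → ∀ ε : ℝ, 0 < ε →
      (∀ (x : Fin (N + 1) → ℝ) (y z0 : ℝ) (u : EVec k) (v : Fin N → EVec m),
        |HN f b0 b1 N ε x y (fun i => if i = 0 then z0 else 0) u v| ≤
          C' * (1 + ‖u‖ ^ 2 + (1 / (N : ℝ)) * ∑ ℓ : Fin N, ‖v ℓ‖ ^ 2)) ∧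
      (∀ (x x' : Fin (N + 1) → ℝ) (y y' : ℝ) (z z' : Fin (N + 1) → ℝ)
          (u : EVec k) (v : Fin N → EVec m),
        |HN f b0 b1 N ε x y z u v - HN f b0 b1 N ε x' y' z' u v| ≤
          C' * (1 + ‖u‖ + ε * ∑ ℓ : Fin N, ‖v ℓ‖) *
              (|x 0 - x' 0| + |y - y'| + |z 0 - z' 0| +
                (1 / (N : ℝ)) *
                  ∑ ℓ : Fin N, (|x ℓ.succ - x' ℓ.succ| + |z ℓ.succ - z' ℓ.succ|)) +
            C' * ε * ∑ ℓ : Fin N, ‖v ℓ‖ * |x ℓ.succ - x' ℓ.succ|) := by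
  have hf : ∀ ξ u v, |f ξ u v| ≤ (3 * C + mu) * (1 + ‖u‖ ^ 2 + ‖v‖ ^ 2) := fun ξ =>
    abs_le_of_hasGradientAt_of_linear_growth hC.le hmu.le (hDu ξ) (hDv ξ) (hAii1 ξ)
      (fun u => by
        have h1 := norm_sub_norm_le (Du ξ u 0) (Du ξ 0 0)
        have h2 := hAii3 ξ ξ u 0 0 0
        simp only [sub_self, norm_zero, sub_zero] at h2
        linarith [hAii4 ξ])
      (fun u v => by
        have h1 := norm_sub_norm_le (Dv ξ u v) (Dv ξ 0 0)
        have h2 := hAii5 ξ ξ u 0 v 0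
        simp only [sub_self, norm_zero, sub_zero] at h2
        linarith [hAii6 ξ])
  refine ⟨3 * C + mu + Cb, by positivity, fun N hN ε hε => ⟨?_, ?_⟩⟩
  · intro x y z0 u v
    simp only [HN, if_true, Fin.succ_ne_zero, if_false, mul_zero, Finset.sum_const_zero, add_zero,
      inner_mean_mul_eq]
    have h1 := abs_mean_le (fun ℓ => hf (x 0, x (Fin.succ ℓ), y, z0, 0) u (v ℓ))
    have h2 := abs_mean_le (N := N) (g := fun ℓ => ⟪z0 • b0 (x 0) (x ℓ.succ) z0, u⟫)
      (h := fun _ => Cb * ‖u‖ + 0) fun ℓ => by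
        rw [add_zero]
        exact (abs_real_inner_le_norm _ _).trans (by gcongr; exact hb0zbdd _ _ _)
    rw [mean_const_add hN] at h2
    rw [← Finset.mul_sum, mul_left_comm, mean_const_add hN] at h1
    simp only [Finset.sum_const_zero, mul_zero, add_zero] at h2
    have hS : 0 ≤ (1 / (N : ℝ)) * ∑ ℓ, ‖v ℓ‖ ^ 2 := by positivity
    refine (abs_add_le _ _).trans ?_
    nlinarith [mul_nonneg hCbpos.le hS, mul_nonneg hCbpos.le (sq_nonneg (‖u‖ - 1)),
      mul_nonneg hCbpos.le (sq_nonneg ‖u‖)]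
  · intro x x' y y' z z' u v
    simp only [HN, inner_mean_mul_eq, mean_inner_mul_eq]
    set X := (1 / (N : ℝ)) * ∑ ℓ : Fin N, |x ℓ.succ - x' ℓ.succ| with hX
    set Z := (1 / (N : ℝ)) * ∑ ℓ : Fin N, |z ℓ.succ - z' ℓ.succ| with hZ
    set W := ∑ ℓ : Fin N, ‖v ℓ‖ * |x ℓ.succ - x' ℓ.succ| with hW
    set V := ∑ ℓ : Fin N, ‖v ℓ‖ with hV
    have hXZ : (1 / (N : ℝ)) * ∑ ℓ : Fin N, (|x ℓ.succ - x' ℓ.succ| + |z ℓ.succ - z' ℓ.succ|)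
        = X + Z := by rw [Finset.sum_add_distrib, mul_add]
    rw [hXZ]
    have hX0 : 0 ≤ X := by positivity
    have hZ0 : 0 ≤ Z := by positivity
    have hV0 : 0 ≤ V := by positivity
    have hW0 : 0 ≤ W := by positivity
    set T := |x 0 - x' 0| + |y - y'| + |z 0 - z' 0| with hT
    have hT0 : 0 ≤ T := by positivity
    have h1 : |(1 / (N : ℝ)) * ∑ ℓ : Fin N, f (x 0, x ℓ.succ, y, z 0, z ℓ.succ) u (v ℓ)
        - (1 / (N : ℝ)) * ∑ ℓ : Fin N, f (x' 0, x' ℓ.succ, y', z' 0, z' ℓ.succ) u (v ℓ)|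
        ≤ C * (T + (X + Z)) := by
      rw [← mul_sub, ← Finset.sum_sub_distrib, ← hXZ, ← mean_const_add hN, mul_left_comm,
        Finset.mul_sum _ _ C]
      refine abs_mean_le fun ℓ => (hAii2 _ _ _ _).trans ?_
      gcongr
      refine (norm_prod_five_le _ _ _ _ _).trans (le_of_eq ?_)
      rw [hT]
      ring
    have h2 : |(1 / (N : ℝ)) * ∑ ℓ : Fin N, ⟪z 0 • b0 (x 0) (x ℓ.succ) (z 0), u⟫
        - (1 / (N : ℝ)) * ∑ ℓ : Fin N, ⟪z' 0 • b0 (x' 0) (x' ℓ.succ) (z' 0), u⟫|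
        ≤ Cb * ‖u‖ * (T + X) := by
      rw [← mul_sub, ← Finset.sum_sub_distrib, ← mean_const_add hN, mul_left_comm,
        Finset.mul_sum _ _ (Cb * ‖u‖)]
      refine abs_mean_le fun ℓ => (abs_inner_sub_inner_le (hb0zlip _ _ _ _ _ _)).trans ?_
      rw [mul_right_comm]
      exact mul_le_mul_of_nonneg_left (by linarith [abs_nonneg (y - y')]) (by positivity)
    have h3 : |ε * ∑ i : Fin N, (1 / (N : ℝ)) * ∑ ℓ : Fin N,
          ⟪z i.succ • b1 (x 0) (x ℓ.succ) (z i.succ), v ℓ⟫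
        - ε * ∑ i : Fin N, (1 / (N : ℝ)) * ∑ ℓ : Fin N,
          ⟪z' i.succ • b1 (x' 0) (x' ℓ.succ) (z' i.succ), v ℓ⟫|
        ≤ ε * (Cb * (|x 0 - x' 0| * V + W + Z * V)) := by
      rw [← mul_sub, abs_mul, abs_of_pos hε, ← Finset.mul_sum, ← Finset.mul_sum, ← mul_sub,
        ← Finset.sum_sub_distrib]
      gcongr
      have hmean : Cb * (|x 0 - x' 0| * V + W + Z * V) = (1 / (N : ℝ)) * ∑ i : Fin N,
          (Cb * (|x 0 - x' 0| * V + W) + Cb * V * |z i.succ - z' i.succ|) := by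
        rw [mean_const_add hN, ← Finset.mul_sum, hZ]
        ring
      rw [hmean]
      refine abs_mean_le fun i => ?_
      have hsum : Cb * (|x 0 - x' 0| * V + W) + Cb * V * |z i.succ - z' i.succ|
          = ∑ ℓ : Fin N, Cb * (|x 0 - x' 0| + |x ℓ.succ - x' ℓ.succ| + |z i.succ - z' i.succ|)
            * ‖v ℓ‖ := by
        rw [hV, hW]
        simp only [Finset.mul_sum, Finset.sum_mul, ← Finset.sum_add_distrib]
        exact Finset.sum_congr rfl fun _ _ => by ring
      rw [hsum, ← Finset.sum_sub_distrib]
      exact (Finset.abs_sum_le_sum_abs _ _).trans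
        (Finset.sum_le_sum fun ℓ _ => abs_inner_sub_inner_le (hb1zlip _ _ _ _ _ _))
    have hxT : |x 0 - x' 0| ≤ T := by
      linarith [abs_nonneg (y - y'), abs_nonneg (z 0 - z' 0)]
    calc _ ≤ C * (T + (X + Z)) + Cb * ‖u‖ * (T + X)
          + ε * (Cb * (|x 0 - x' 0| * V + W + Z * V)) := by
          refine le_trans (le_of_eq (congrArg _ ?_))
            ((abs_add_three _ _ _).trans (add_le_add_three h1 h2 h3))
          ring
      _ ≤ (3 * C + mu + Cb) * 1 * (T + (X + Z)) + (3 * C + mu + Cb) * ‖u‖ * (T + (X + Z))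
          + ε * ((3 * C + mu + Cb) * (T * V + W + X * V + Z * V)) := by
          have hsum : |x 0 - x' 0| * V + W + Z * V ≤ T * V + W + X * V + Z * V := by
            have : 0 ≤ X * V := by positivity
            have : |x 0 - x' 0| * V ≤ T * V := by gcongr
            linarith
          have hK : Cb ≤ 3 * C + mu + Cb := by linarith
          have hK' : C ≤ (3 * C + mu + Cb) * 1 := by linarith
          have hTX : T + X ≤ T + (X + Z) := by linarith
          exact add_le_add_three (by gcongr) (by gcongr)
            (mul_le_mul_of_nonneg_left (mul_le_mul hK hsum (by positivity) (by positivity)) hε.le)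
      _ = _ := by ring
end
end

section
/- Define H̄_N(ξ^{(N)}) := H_N(ξ^{(N)}, ū^N(ξ^{(N)}), v̄^{(N)}(ξ^{(N)})). Then: 1) there is a constant C' independent of N ≥ 1 and of ε_N such that |H̄_N(ξ^{(N,0)})| ≤ C' for every ξ^{(N,0)} = (x^{(N)}, y, (z₀,0,…,0)) ∈ ℝ^{N+1} × ℝ × ℝ^{N+1}; 2) for each N ≥ 1 there is a constant C_N (depending on N and ε_N) such that |H̄_N(ξ^{(N)}) − H̄_N(ξ̃^{(N)})| ≤ C_N |ξ^{(N)} − ξ̃^{(N)}| for all ξ^{(N)}, ξ̃^{(N)} ∈ ℝ^{N+1} × ℝ × ℝ^{N+1}. -/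
open scoped RealInnerProductSpace BigOperators
open MeasureTheory

noncomputable section

section StronglyMonotone

variable {E : Type*} [NormedAddCommGroup E] [InnerProductSpace ℝ E] [CompleteSpace E]

/-- A minimizer of a function with strongly monotone gradient is controlled by the gradient at
the origin. -/
lemma mul_norm_le_of_forall_le {φ : E → ℝ} {D : E → E} {lam : ℝ} {w : E}
    (hφ : HasGradientAt φ (D w) w)
    (hD : lam * ‖w‖ ^ 2 ≤ ⟪D w - D 0, w⟫) (hmin : ∀ w', φ w ≤ φ w') :
    lam * ‖w‖ ≤ ‖D 0‖ := by
  have hzero : D w = 0 := by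
    have h := IsLocalMin.hasFDerivAt_eq_zero (Filter.Eventually.of_forall hmin)
      hφ.hasFDerivAt
    simpa using h
  rcases eq_or_ne w 0 with rfl | hw
  · simp
  · have hpos : 0 < ‖w‖ := norm_pos_iff.mpr hw
    have hcs : ⟪D w - D 0, w⟫ ≤ ‖D 0‖ * ‖w‖ := by
      simpa [hzero] using real_inner_le_norm (D w - D 0) w
    refine le_of_mul_le_mul_right ?_ hpos
    nlinarith

lemma hasGradientAt_inner_left (p w : E) : HasGradientAt (fun w' => ⟪p, w'⟫) p w := by
  rw [hasGradientAt_iff_hasFDerivAt]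
  exact (InnerProductSpace.toDual ℝ E p).hasFDerivAt

lemma HasGradientAt.add_fun {φ ψ : E → ℝ} {a b w : E} (hφ : HasGradientAt φ a w)
    (hψ : HasGradientAt ψ b w) : HasGradientAt (fun w' => φ w' + ψ w') (a + b) w := by
  rw [hasGradientAt_iff_hasFDerivAt, map_add]
  exact hφ.hasFDerivAt.add hψ.hasFDerivAt

lemma HasGradientAt.neg_sum {ι : Type*} [Fintype ι] {φ : ι → E → ℝ} {a : ι → E} {w : E}
    (hφ : ∀ i, HasGradientAt (φ i) (a i) w) :
    HasGradientAt (fun w' => -∑ i, φ i w') (-∑ i, a i) w := by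
  rw [hasGradientAt_iff_hasFDerivAt, map_neg, map_sum]
  exact (HasFDerivAt.fun_sum fun i _ => (hφ i).hasFDerivAt).neg

/-- Growth of a function whose gradient is bounded on a ball. -/
lemma abs_sub_le_of_gradient_bound {φ : E → ℝ} {D : E → E} {K R : ℝ}
    (hφ : ∀ w, HasGradientAt φ (D w) w) (hD : ∀ w, ‖w‖ ≤ R → ‖D w‖ ≤ K) {w : E}
    (hw : ‖w‖ ≤ R) : |φ w - φ 0| ≤ K * R := by
  have hR : 0 ≤ R := (norm_nonneg w).trans hw
  have hK : 0 ≤ K := (norm_nonneg _).trans (hD w hw)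
  have h := (convex_closedBall (0 : E) R).norm_image_sub_le_of_norm_hasFDerivWithin_le
    (f := φ) (f' := fun w' => InnerProductSpace.toDual ℝ E (D w')) (C := K)
    (fun w' _ => (hφ w').hasFDerivAt.hasFDerivWithinAt)
    (fun w' hw' => by
      rw [LinearIsometryEquiv.norm_map]
      exact hD w' (by simpa using hw'))
    (x := 0) (y := w) (by simpa using hR) (by simpa using hw)
  rw [Real.norm_eq_abs, sub_zero] at h
  exact h.trans (mul_le_mul_of_nonneg_left hw hK)

end StronglyMonotone

section SaddlePoint

variable {E F T ι : Type*} [NormedAddCommGroup E] [InnerProductSpace ℝ E] [CompleteSpace E]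
  [NormedAddCommGroup F] [InnerProductSpace ℝ F] [CompleteSpace F] [Fintype ι]

/-- A priori bound for the saddle points of a separable sum of linearly perturbed strongly
concave-convex functions. -/
lemma saddle_norm_le [Nonempty ι] {C lam mu P Q : ℝ} (hmu : 0 < mu) (hmulam : mu < lam)
    {f : T → E → F → ℝ} {Du : T → E → F → E} {Dv : T → E → F → F}
    (hDu : ∀ ξ v u, HasGradientAt (fun u' => f ξ u' v) (Du ξ u v) u)
    (hDv : ∀ ξ u v, HasGradientAt (fun v' => f ξ u v') (Dv ξ u v) v)
    (hmonou : ∀ ξ u u' v, ⟪Du ξ u v - Du ξ u' v, u - u'⟫ ≤ -lam * ‖u - u'‖ ^ 2)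
    (hmonov : ∀ ξ u v v', ⟪Dv ξ u v - Dv ξ u v', v - v'⟫ ≥ lam * ‖v - v'‖ ^ 2)
    (hDu0 : ∀ ξ v, ‖Du ξ 0 v‖ ≤ C + mu * ‖v‖)
    (hDv0 : ∀ ξ u, ‖Dv ξ u 0‖ ≤ C + mu * ‖u‖)
    (ξ : ι → T) (p : ι → E) (q : ι → F) (hp : ∀ ℓ, ‖p ℓ‖ ≤ P) (hq : ∀ ℓ, ‖q ℓ‖ ≤ Q)
    (u : E) (v : ι → F)
    (hu : ∀ u', ∑ ℓ, (f (ξ ℓ) u' (v ℓ) + ⟪p ℓ, u'⟫ + ⟪q ℓ, v ℓ⟫) ≤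
      ∑ ℓ, (f (ξ ℓ) u (v ℓ) + ⟪p ℓ, u⟫ + ⟪q ℓ, v ℓ⟫))
    (hv : ∀ v' : ι → F, ∑ ℓ, (f (ξ ℓ) u (v ℓ) + ⟪p ℓ, u⟫ + ⟪q ℓ, v ℓ⟫) ≤
      ∑ ℓ, (f (ξ ℓ) u (v' ℓ) + ⟪p ℓ, u⟫ + ⟪q ℓ, v' ℓ⟫)) :
    ‖u‖ ≤ (2 * C + P + Q) / (lam - mu) ∧ ∀ ℓ, ‖v ℓ‖ ≤ (2 * C + P + Q) / (lam - mu) := by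
  classical
  have hgap : 0 < lam - mu := sub_pos.mpr hmulam
  have hvℓ : ∀ ℓ, lam * ‖v ℓ‖ ≤ C + Q + mu * ‖u‖ := by
    intro ℓ
    have key := mul_norm_le_of_forall_le (φ := fun w => f (ξ ℓ) u w + ⟪q ℓ, w⟫)
      (D := fun w => Dv (ξ ℓ) u w + q ℓ) (lam := lam) (w := v ℓ)
      ((hDv _ _ _).add_fun (hasGradientAt_inner_left _ _))
      (by simpa using hmonov (ξ ℓ) u (v ℓ) 0)
      (by
        intro w
        have h := hv (Function.update v ℓ w)
        rw [← Finset.add_sum_erase _ _ (Finset.mem_univ ℓ),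
          ← Finset.add_sum_erase _ _ (Finset.mem_univ ℓ)] at h
        have hrest : ∀ i ∈ Finset.univ.erase ℓ,
            f (ξ i) u (Function.update v ℓ w i) + ⟪p i, u⟫ + ⟪q i, Function.update v ℓ w i⟫ =
              f (ξ i) u (v i) + ⟪p i, u⟫ + ⟪q i, v i⟫ := by
          intro i hi
          rw [Function.update_of_ne (Finset.ne_of_mem_erase hi)]
        rw [Finset.sum_congr rfl hrest, Function.update_self] at h
        linarith)
    linarith [norm_add_le (Dv (ξ ℓ) u 0) (q ℓ), hDv0 (ξ ℓ) u, hq ℓ]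
  set n : ℝ := (Fintype.card ι : ℝ) with hn
  have hnpos : 0 < n := by rw [hn]; exact_mod_cast Fintype.card_pos
  set W : ℝ := ∑ ℓ, ‖v ℓ‖ with hW
  have hsumv : lam * W ≤ n * (C + Q + mu * ‖u‖) := by
    have h := Finset.sum_le_sum fun ℓ (_ : ℓ ∈ Finset.univ) => hvℓ ℓ
    simpa only [← Finset.mul_sum, ← hW, Finset.sum_const, Finset.card_univ, nsmul_eq_mul, ← hn]
      using h
  have hsumu : n * lam * ‖u‖ ≤ n * (C + P) + mu * W := by
    have key := mul_norm_le_of_forall_le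
      (φ := fun u' => -∑ ℓ, (f (ξ ℓ) u' (v ℓ) + ⟪p ℓ, u'⟫))
      (D := fun u' => -∑ ℓ, (Du (ξ ℓ) u' (v ℓ) + p ℓ)) (lam := n * lam) (w := u)
      (HasGradientAt.neg_sum fun ℓ => (hDu _ _ _).add_fun (hasGradientAt_inner_left _ _))
      (by
        have h := Finset.sum_le_sum fun ℓ (_ : ℓ ∈ Finset.univ) => hmonou (ξ ℓ) u 0 (v ℓ)
        rw [← sum_inner] at h
        have heq : -∑ ℓ, (Du (ξ ℓ) u (v ℓ) + p ℓ) - -∑ ℓ, (Du (ξ ℓ) 0 (v ℓ) + p ℓ) =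
            -∑ ℓ, (Du (ξ ℓ) u (v ℓ) - Du (ξ ℓ) 0 (v ℓ)) := by
          simp only [Finset.sum_add_distrib, Finset.sum_sub_distrib]
          abel
        rw [heq, inner_neg_left]
        simp only [sub_zero, Finset.sum_const, Finset.card_univ, nsmul_eq_mul, ← hn] at h ⊢
        linarith)
      (by
        intro u'
        have h := hu u'
        simp only [Finset.sum_add_distrib] at h ⊢
        linarith)
    rw [norm_neg] at key
    refine key.trans ((norm_sum_le _ _).trans ?_)
    have h : ∀ ℓ ∈ Finset.univ, ‖Du (ξ ℓ) 0 (v ℓ) + p ℓ‖ ≤ (C + P) + mu * ‖v ℓ‖ := by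
      intro ℓ _
      linarith [norm_add_le (Du (ξ ℓ) 0 (v ℓ)) (p ℓ), hDu0 (ξ ℓ) (v ℓ), hp ℓ]
    refine (Finset.sum_le_sum h).trans (le_of_eq ?_)
    rw [Finset.sum_add_distrib, ← Finset.mul_sum, Finset.sum_const, Finset.card_univ,
      nsmul_eq_mul, ← hn]
  have hWnn : 0 ≤ W := Finset.sum_nonneg fun ℓ _ => norm_nonneg _
  have hubound : (lam - mu) * ‖u‖ ≤ 2 * C + P + Q := by
    refine le_of_mul_le_mul_left ?_ hnpos
    nlinarith [mul_nonneg hgap.le hWnn]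
  refine ⟨by rw [le_div_iff₀ hgap]; linarith, fun ℓ => ?_⟩
  obtain ⟨ℓ₀⟩ := ‹Nonempty ι›
  have hP : 0 ≤ P := (norm_nonneg _).trans (hp ℓ₀)
  have hC : 0 ≤ C := by simpa using (norm_nonneg _).trans (hDu0 (ξ ℓ₀) 0)
  rw [le_div_iff₀ hgap]
  refine le_of_mul_le_mul_left ?_ (hmu.trans hmulam)
  nlinarith [mul_le_mul_of_nonneg_left (hvℓ ℓ) hgap.le,
    mul_le_mul_of_nonneg_left hubound hmu.le, mul_nonneg hgap.le hP, mul_nonneg hgap.le hC]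

end SaddlePoint

/-- `H_N` as an average of functions of `(u, v_ℓ)`. -/
lemma HN_eq {k m : ℕ} (f : ℝ × ℝ × ℝ × ℝ × ℝ → EVec k → EVec m → ℝ)
    (b0 : ℝ → ℝ → ℝ → EVec k) (b1 : ℝ → ℝ → ℝ → EVec m)
    (N : ℕ) (ε : ℝ) (x : Fin (N + 1) → ℝ) (y : ℝ) (z : Fin (N + 1) → ℝ)
    (u : EVec k) (v : Fin N → EVec m) :
    HN f b0 b1 N ε x y z u v =
      (1 / (N : ℝ)) * ∑ ℓ : Fin N, (f (x 0, x ℓ.succ, y, z 0, z ℓ.succ) u (v ℓ)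
        + ⟪z 0 • b0 (x 0) (x ℓ.succ) (z 0), u⟫
        + ⟪ε • ∑ i : Fin N, z i.succ • b1 (x 0) (x ℓ.succ) (z i.succ), v ℓ⟫) := by
  have h0 : ⟪(1 / (N : ℝ)) • ∑ ℓ : Fin N, b0 (x 0) (x ℓ.succ) (z 0), u⟫ * z 0 =
      (1 / (N : ℝ)) * ∑ ℓ : Fin N, ⟪z 0 • b0 (x 0) (x ℓ.succ) (z 0), u⟫ := by
    simp only [real_inner_smul_left, sum_inner, ← Finset.mul_sum]
    ring
  have h1 : ε * ∑ i : Fin N,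
        ((1 / (N : ℝ)) * ∑ ℓ : Fin N, ⟪b1 (x 0) (x ℓ.succ) (z i.succ), v ℓ⟫) * z i.succ =
      (1 / (N : ℝ)) * ∑ ℓ : Fin N,
        ⟪ε • ∑ i : Fin N, z i.succ • b1 (x 0) (x ℓ.succ) (z i.succ), v ℓ⟫ := by
    simp only [real_inner_smul_left, sum_inner, Finset.mul_sum, Finset.sum_mul]
    rw [Finset.sum_comm]
    refine Finset.sum_congr rfl fun ℓ _ => Finset.sum_congr rfl fun i _ => ?_
    ring
  rw [HN, h0, h1, Finset.sum_add_distrib, Finset.sum_add_distrib]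
  ring

lemma abs_average_le {N : ℕ} (hN : 1 ≤ N) {a : Fin N → ℝ} {K : ℝ} (h : ∀ ℓ, |a ℓ| ≤ K) :
    |(1 / (N : ℝ)) * ∑ ℓ, a ℓ| ≤ K := by
  have hNpos : (0 : ℝ) < N := by exact_mod_cast hN
  rw [abs_mul, abs_of_pos (by positivity : (0 : ℝ) < 1 / N), one_div, inv_mul_le_iff₀ hNpos]
  refine (Finset.abs_sum_le_sum_abs _ _).trans ?_
  simpa using Finset.sum_le_sum fun ℓ (_ : ℓ ∈ Finset.univ) => h ℓ

lemma abs_inner_le_mul {E : Type*} [NormedAddCommGroup E] [InnerProductSpace ℝ E] {p w : E}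
    {P R : ℝ} (hp : ‖p‖ ≤ P) (hw : ‖w‖ ≤ R) : |⟪p, w⟫| ≤ P * R :=
  (abs_real_inner_le_norm p w).trans
    (mul_le_mul hp hw (norm_nonneg w) ((norm_nonneg p).trans hp))


/-- Properties of `H̄_N(ξ^{(N)}) := H_N(ξ^{(N)}, ū^N(ξ^{(N)}), v̄^{(N)}(ξ^{(N)}))`:
uniform boundedness along `ξ^{(N,0)}` and (`N`-dependent) Lipschitz continuity. -/
theorem HbarN_bounded_and_lipschitz
    (k m : ℕ) (hk : 1 ≤ k) (hm : 1 ≤ m)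
    (C lam mu : ℝ) (hC : 0 < C) (hmu : 0 < mu) (hmulam : mu < lam)
    (f : ℝ × ℝ × ℝ × ℝ × ℝ → EVec k → EVec m → ℝ)
    (Du : ℝ × ℝ × ℝ × ℝ × ℝ → EVec k → EVec m → EVec k)
    (Dv : ℝ × ℝ × ℝ × ℝ × ℝ → EVec k → EVec m → EVec m)
    (hf_cont : Continuous fun p : (ℝ × ℝ × ℝ × ℝ × ℝ) × EVec k × EVec m => f p.1 p.2.1 p.2.2)
    (hDu : ∀ ξ v u, HasGradientAt (fun u' => f ξ u' v) (Du ξ u v) u)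
    (hDv : ∀ ξ u v, HasGradientAt (fun v' => f ξ u v') (Dv ξ u v) v)
    (hD_cont : ∀ ξ, Continuous fun p : EVec k × EVec m => (Du ξ p.1 p.2, Dv ξ p.1 p.2))
    (hAiu : ∀ ξ u u' v, ⟪Du ξ u v - Du ξ u' v, u - u'⟫ ≤ -lam * ‖u - u'‖ ^ 2)
    (hAiv : ∀ ξ u v v', ⟪Dv ξ u v - Dv ξ u v', v - v'⟫ ≥ lam * ‖v - v'‖ ^ 2)
    (hAii1 : ∀ ξ, |f ξ 0 0| ≤ C)
    (hAii2 : ∀ ξ ξ' u v, |f ξ u v - f ξ' u v| ≤ C * ‖ξ - ξ'‖)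
    (hAii3 : ∀ ξ ξ' u u' v v',
      ‖Du ξ u v - Du ξ' u' v'‖ ≤ C * (‖ξ - ξ'‖ + ‖u - u'‖) + mu * ‖v - v'‖)
    (hAii4 : ∀ ξ, ‖Du ξ 0 0‖ ≤ C)
    (hAii5 : ∀ (ξ ξ' : ℝ × ℝ × ℝ × ℝ × ℝ) u u' v v',
      ‖Dv ξ u v - Dv ξ' u' v'‖ ≤
        C * (‖(ξ.1, ξ.2.1, ξ.2.2.1, ξ.2.2.2.1) - (ξ'.1, ξ'.2.1, ξ'.2.2.1, ξ'.2.2.2.1)‖ +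
          ‖v - v'‖) + mu * ‖u - u'‖)
    (hAii6 : ∀ ξ, ‖Dv ξ 0 0‖ ≤ C)
    (b0 : ℝ → ℝ → ℝ → EVec k) (b1 : ℝ → ℝ → ℝ → EVec m)
    (Cb : ℝ) (hCbpos : 0 < Cb)
    (hb0cont : Continuous fun p : ℝ × ℝ × ℝ => b0 p.1 p.2.1 p.2.2)
    (hb1cont : Continuous fun p : ℝ × ℝ × ℝ => b1 p.1 p.2.1 p.2.2)
    (hb0bdd : ∀ x0 x1 z, ‖b0 x0 x1 z‖ ≤ Cb)
    (hb1bdd : ∀ x0 x1 z, ‖b1 x0 x1 z‖ ≤ Cb)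
    (hb0zbdd : ∀ x0 x1 z, ‖z • b0 x0 x1 z‖ ≤ Cb)
    (hb1zbdd : ∀ x0 x1 z, ‖z • b1 x0 x1 z‖ ≤ Cb)
    (hb0zlip : ∀ x0 x1 z x0' x1' z',
      ‖z • b0 x0 x1 z - z' • b0 x0' x1' z'‖ ≤ Cb * (|x0 - x0'| + |x1 - x1'| + |z - z'|))
    (hb1zlip : ∀ x0 x1 z x0' x1' z',
      ‖z • b1 x0 x1 z - z' • b1 x0' x1' z'‖ ≤ Cb * (|x0 - x0'| + |x1 - x1'| + |z - z'|))
    (εs : ℕ → ℝ) (hεs : ∀ N, 0 < εs N)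
    (ubar : (N : ℕ) → (Fin (N + 1) → ℝ) → ℝ → (Fin (N + 1) → ℝ) → EVec k)
    (vbar : (N : ℕ) → (Fin (N + 1) → ℝ) → ℝ → (Fin (N + 1) → ℝ) → Fin N → EVec m)
    (hsaddle : ∀ N x y z u v,
      HN f b0 b1 N (εs N) x y z u (vbar N x y z) ≤
          HN f b0 b1 N (εs N) x y z (ubar N x y z) (vbar N x y z) ∧
        HN f b0 b1 N (εs N) x y z (ubar N x y z) (vbar N x y z) ≤
          HN f b0 b1 N (εs N) x y z (ubar N x y z) v)
    :
    (∃ C' : ℝ, 0 < C' ∧ ∀ N : ℕ, 1 ≤ N → ∀ (x : Fin (N + 1) → ℝ) (y z0 : ℝ),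
      |HN f b0 b1 N (εs N) x y (fun i => if i = 0 then z0 else 0)
          (ubar N x y fun i => if i = 0 then z0 else 0)
          (vbar N x y fun i => if i = 0 then z0 else 0)| ≤ C') ∧
    ∀ N : ℕ, 1 ≤ N → ∃ CN : ℝ, 0 < CN ∧
      ∀ (x x' : Fin (N + 1) → ℝ) (y y' : ℝ) (z z' : Fin (N + 1) → ℝ),
        |HN f b0 b1 N (εs N) x y z (ubar N x y z) (vbar N x y z) -
            HN f b0 b1 N (εs N) x' y' z' (ubar N x' y' z') (vbar N x' y' z')| ≤
          CN * Real.sqrt ((∑ i, (x i - x' i) ^ 2) + (y - y') ^ 2 +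
            ∑ i, (z i - z' i) ^ 2) := by
  have hDu0 : ∀ ξ v, ‖Du ξ 0 v‖ ≤ C + mu * ‖v‖ := by
    intro ξ v
    have h := hAii3 ξ ξ 0 0 v 0
    simp only [sub_self, norm_zero, add_zero, mul_zero, zero_add, sub_zero] at h
    linarith [norm_le_norm_add_norm_sub (Du ξ 0 0) (Du ξ 0 v),
      norm_sub_rev (Du ξ 0 0) (Du ξ 0 v), hAii4 ξ]
  have hDv0 : ∀ ξ u, ‖Dv ξ u 0‖ ≤ C + mu * ‖u‖ := by
    intro ξ u
    have h := hAii5 ξ ξ u 0 0 0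
    simp only [sub_self, norm_zero, add_zero, mul_zero, zero_add, sub_zero] at h
    linarith [norm_le_norm_add_norm_sub (Dv ξ 0 0) (Dv ξ u 0),
      norm_sub_rev (Dv ξ 0 0) (Dv ξ u 0), hAii6 ξ]
  have hgap : 0 < lam - mu := sub_pos.mpr hmulam
  have hbound : ∀ N, 1 ≤ N → ∀ x y z (Q : ℝ),
      (∀ ℓ : Fin N, ‖εs N • ∑ i : Fin N, z i.succ • b1 (x 0) (x ℓ.succ) (z i.succ)‖ ≤ Q) →
      ‖ubar N x y z‖ ≤ (2 * C + Cb + Q) / (lam - mu) ∧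
        ∀ ℓ, ‖vbar N x y z ℓ‖ ≤ (2 * C + Cb + Q) / (lam - mu) := by
    intro N hN x y z Q hQ
    have : Nonempty (Fin N) := ⟨⟨0, hN⟩⟩
    have hNpos : (0 : ℝ) < 1 / N := by
      have : (0 : ℝ) < N := by exact_mod_cast hN
      positivity
    refine saddle_norm_le hmu hmulam hDu hDv hAiu hAiv hDu0 hDv0
      (fun ℓ : Fin N => (x 0, x ℓ.succ, y, z 0, z ℓ.succ))
      (fun ℓ => z 0 • b0 (x 0) (x ℓ.succ) (z 0)) _ (fun ℓ => hb0zbdd _ _ _) hQ _ _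
      (fun u' => ?_) (fun v' => ?_)
    · have h := (hsaddle N x y z u' 0).1
      rw [HN_eq, HN_eq] at h
      exact le_of_mul_le_mul_left h hNpos
    · have h := (hsaddle N x y z 0 v').2
      rw [HN_eq, HN_eq] at h
      exact le_of_mul_le_mul_left h hNpos
  refine ⟨?_, fun N hN => ?_⟩
  · set R : ℝ := (2 * C + Cb + 0) / (lam - mu) with hRdef
    have hR : 0 < R := by positivity
    have hfbound : ∀ ξ u v, ‖u‖ ≤ R → ‖v‖ ≤ R →
        |f ξ u v| ≤ C + (C + C * R) * R + (C + C * R + mu * R) * R := by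
      intro ξ u v hu hv
      have h1 : |f ξ u v - f ξ 0 v| ≤ (C + C * R + mu * R) * R := by
        refine abs_sub_le_of_gradient_bound (hDu ξ v) (fun w hw => ?_) hu
        have h := hAii3 ξ ξ w 0 v v
        simp only [sub_self, norm_zero, add_zero, mul_zero, zero_add, sub_zero] at h
        have h' := norm_le_norm_add_norm_sub (Du ξ 0 v) (Du ξ w v)
        nlinarith [norm_sub_rev (Du ξ 0 v) (Du ξ w v), hDu0 ξ v]
      have h2 : |f ξ 0 v - f ξ 0 0| ≤ (C + C * R) * R := by
        refine abs_sub_le_of_gradient_bound (hDv ξ 0) (fun w hw => ?_) hv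
        have h := hAii5 ξ ξ 0 0 w 0
        simp only [sub_self, norm_zero, add_zero, mul_zero, zero_add, sub_zero] at h
        have h' := norm_le_norm_add_norm_sub (Dv ξ 0 0) (Dv ξ 0 w)
        nlinarith [norm_sub_rev (Dv ξ 0 0) (Dv ξ 0 w), hAii6 ξ]
      have h3 := hAii1 ξ
      rw [abs_le] at h1 h2 h3 ⊢
      constructor <;> linarith
    refine ⟨C + (C + C * R) * R + (C + C * R + mu * R) * R + Cb * R, by positivity,
      fun N hN x y z0 => ?_⟩
    set z : Fin (N + 1) → ℝ := fun i => if i = 0 then z0 else 0 with hz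
    have hq : ∀ ℓ : Fin N,
        εs N • ∑ i : Fin N, z i.succ • b1 (x 0) (x ℓ.succ) (z i.succ) = 0 := by
      intro ℓ
      simp [hz]
    obtain ⟨hu, hv⟩ := hbound N hN x y z 0 fun ℓ => by rw [hq, norm_zero]
    rw [HN_eq]
    refine abs_average_le hN fun ℓ => ?_
    rw [hq, inner_zero_left, add_zero]
    exact (abs_add_le _ _).trans
      (add_le_add (hfbound _ _ _ hu (hv ℓ)) (abs_inner_le_mul (hb0zbdd _ _ _) hu))
  · have hε := hεs N
    have hsum : ∀ w : Fin N → EVec m, ∀ K : ℝ, (∀ i, ‖w i‖ ≤ K) →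
        ‖εs N • ∑ i, w i‖ ≤ εs N * (N * K) := by
      intro w K hw
      rw [norm_smul, Real.norm_of_nonneg hε.le]
      refine mul_le_mul_of_nonneg_left ((norm_sum_le _ _).trans ?_) hε.le
      simpa using Finset.sum_le_sum fun i (_ : i ∈ Finset.univ) => hw i
    set R : ℝ := (2 * C + Cb + εs N * (N * Cb)) / (lam - mu) with hRdef
    have hR : 0 < R := by positivity
    have hR' : ∀ x y z, ‖ubar N x y z‖ ≤ R ∧ ∀ ℓ, ‖vbar N x y z ℓ‖ ≤ R := fun x y z =>
      hbound N hN x y z _ fun ℓ => hsum _ _ fun i => hb1zbdd _ _ _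
    refine ⟨C + Cb * 3 * R + εs N * (N * (Cb * 3)) * R, by positivity, ?_⟩
    have hone : ∀ (x x' : Fin (N + 1) → ℝ) (y y' : ℝ) (z z' : Fin (N + 1) → ℝ),
        HN f b0 b1 N (εs N) x y z (ubar N x y z) (vbar N x y z) -
            HN f b0 b1 N (εs N) x' y' z' (ubar N x' y' z') (vbar N x' y' z') ≤
          (C + Cb * 3 * R + εs N * (N * (Cb * 3)) * R) *
            Real.sqrt ((∑ i, (x i - x' i) ^ 2) + (y - y') ^ 2 + ∑ i, (z i - z' i) ^ 2) := by
      intro x x' y y' z z'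
      set S : ℝ := Real.sqrt ((∑ i, (x i - x' i) ^ 2) + (y - y') ^ 2 + ∑ i, (z i - z' i) ^ 2)
        with hS
      have hxnn : 0 ≤ ∑ i, (x i - x' i) ^ 2 := Finset.sum_nonneg fun _ _ => sq_nonneg _
      have hznn : 0 ≤ ∑ i, (z i - z' i) ^ 2 := Finset.sum_nonneg fun _ _ => sq_nonneg _
      have hx : ∀ i, |x i - x' i| ≤ S := fun i => Real.abs_le_sqrt (by
        linarith [Finset.single_le_sum (f := fun i => (x i - x' i) ^ 2)
          (fun _ _ => sq_nonneg _) (Finset.mem_univ i), sq_nonneg (y - y')])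
      have hz : ∀ i, |z i - z' i| ≤ S := fun i => Real.abs_le_sqrt (by
        linarith [Finset.single_le_sum (f := fun i => (z i - z' i) ^ 2)
          (fun _ _ => sq_nonneg _) (Finset.mem_univ i), sq_nonneg (y - y')])
      have hy : |y - y'| ≤ S := Real.abs_le_sqrt (by linarith)
      obtain ⟨hu, -⟩ := hR' x y z
      obtain ⟨-, hv⟩ := hR' x' y' z'
      have h1 := (hsaddle N x y z 0 (vbar N x' y' z')).2
      have h2 := (hsaddle N x' y' z' (ubar N x y z) 0).1
      refine (sub_le_sub h1 h2).trans ((le_abs_self _).trans ?_)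
      generalize ubar N x y z = u at hu
      generalize vbar N x' y' z' = v at hv
      rw [HN_eq, HN_eq, ← mul_sub, ← Finset.sum_sub_distrib]
      refine abs_average_le hN fun ℓ => ?_
      have hf := (hAii2 (x 0, x ℓ.succ, y, z 0, z ℓ.succ)
        (x' 0, x' ℓ.succ, y', z' 0, z' ℓ.succ) u (v ℓ)).trans
        (mul_le_mul_of_nonneg_left (c := S) (by simp [Prod.norm_def, hx, hy, hz]) hC.le)
      have hp := abs_inner_le_mul ((hb0zlip (x 0) (x ℓ.succ) (z 0) (x' 0) (x' ℓ.succ) (z' 0)).trans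
        (by nlinarith [hx 0, hx ℓ.succ, hz 0] : _ ≤ Cb * 3 * S)) hu
      have hq := abs_inner_le_mul (hsum
        (fun i => z i.succ • b1 (x 0) (x ℓ.succ) (z i.succ) -
          z' i.succ • b1 (x' 0) (x' ℓ.succ) (z' i.succ)) (Cb * 3 * S)
        fun i => (hb1zlip _ _ _ _ _ _).trans
          (by nlinarith [hx 0, hx ℓ.succ, hz i.succ])) (hv ℓ)
      rw [Finset.sum_sub_distrib, smul_sub, inner_sub_left] at hq
      rw [inner_sub_left] at hp
      rw [abs_le] at hf hp hq ⊢
      constructor <;> linarith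
    intro x x' y y' z z'
    refine abs_sub_le_iff.mpr ⟨hone x x' y y' z z', ?_⟩
    have h := hone x' x y' y z' z
    simpa only [sub_sq_comm (x' _), sub_sq_comm y', sub_sq_comm (z' _)] using h
end
end

section
/- For every ξ = (x₀,x₁,y,z₀) ∈ ℝ⁴, the function u ↦ f_{v̄}(ξ,u) is continuously differentiable on U and its derivative is given by the envelope formula D_u f_{v̄}(ξ,u) = D_u f(x₀,x₁,y,z₀,0,u,v̄(ξ,u)) for all u ∈ U. -/
open scoped RealInnerProductSpace BigOperators
open MeasureTheory

noncomputable section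

/-- Zeros of strongly monotone maps depend Lipschitz continuously on the parameter. -/
theorem mul_norm_sub_le_of_strongly_monotone_zero {E G : Type*}
    [SeminormedAddCommGroup E] [NormedAddCommGroup G] [InnerProductSpace ℝ G]
    {D : E → G → G} {w : E → G} {lam mu : ℝ}
    (hmono : ∀ u v v', lam * ‖v - v'‖ ^ 2 ≤ ⟪D u v - D u v', v - v'⟫)
    (hlip : ∀ u u' v, ‖D u v - D u' v‖ ≤ mu * ‖u - u'‖)
    (hzero : ∀ u, D u (w u) = 0) (u u' : E) :
    lam * ‖w u - w u'‖ ≤ mu * ‖u - u'‖ := by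
  have hnn : 0 ≤ mu * ‖u - u'‖ := (norm_nonneg _).trans (hlip u u' 0)
  rcases (norm_nonneg (w u - w u')).eq_or_lt with h0 | h0
  · rwa [← h0, mul_zero]
  · have h1 := hmono u (w u) (w u')
    have h2 := real_inner_le_norm (D u (w u) - D u (w u')) (w u - w u')
    have h3 := hlip u' u (w u')
    rw [hzero u', norm_sub_rev u' u] at h3
    rw [hzero u] at h1 h2
    refine le_of_mul_le_mul_right ?_ h0
    have h4 := mul_le_mul_of_nonneg_right h3 h0.le
    nlinarith

section Envelope

variable {E G : Type*} [NormedAddCommGroup E] [InnerProductSpace ℝ E] [CompleteSpace E]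
  [NormedAddCommGroup G] [InnerProductSpace ℝ G] [CompleteSpace G]

theorem HasGradientAt.eq_zero_of_forall_le {φ : G → ℝ} {g v : G} (h : HasGradientAt φ g v)
    (hmin : ∀ w, φ v ≤ φ w) : g = 0 := by
  have h0 := IsLocalMin.hasFDerivAt_eq_zero (Filter.Eventually.of_forall hmin) h.hasFDerivAt
  simpa using h0

/-- Quantitative first order expansion of a function with Lipschitz gradient. -/
theorem abs_sub_sub_inner_le_of_gradient_bound {φ : E → ℝ} {φ' : E → E} {g u u' : E} {C δ : ℝ}
    (hC : 0 ≤ C) (hφ : ∀ w, HasGradientAt φ (φ' w) w)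
    (hbound : ∀ w, ‖φ' w - g‖ ≤ C * ‖w - u‖ + δ) :
    |φ u' - φ u - ⟪g, u' - u⟫| ≤ (C * ‖u' - u‖ + δ) * ‖u' - u‖ := by
  have key := Convex.norm_image_sub_le_of_norm_hasFDerivWithin_le'
    (φ := InnerProductSpace.toDual ℝ E g) (C := C * ‖u' - u‖ + δ)
    (fun w _ => (hφ w).hasFDerivAt.hasFDerivWithinAt) ?_
    (convex_closedBall u ‖u' - u‖) (x := u) (y := u') (by simp)
    (by simp [dist_eq_norm])
  · simpa using key
  · intro w hw
    rw [← map_sub, LinearIsometryEquiv.norm_map]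
    have hw' : ‖w - u‖ ≤ ‖u' - u‖ := by simpa [dist_eq_norm] using hw
    exact (hbound w).trans (by gcongr)

theorem hasGradientAt_of_abs_sub_sub_inner_le {F : E → ℝ} {g u : E} {K : ℝ}
    (h : ∀ u', |F u' - F u - ⟪g, u' - u⟫| ≤ K * ‖u' - u‖ ^ 2) : HasGradientAt F g u := by
  rw [hasGradientAt_iff_isLittleO]
  refine (Asymptotics.IsBigO.of_bound K (Filter.Eventually.of_forall fun u' => ?_)).trans_isLittleO
    (Asymptotics.isLittleO_pow_sub_sub u (one_lt_two))
  simpa using h u'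

end Envelope

/-- Envelope formula (4.44): `f_{v̄}(ξ, ·)` is continuously differentiable with
`D_u f_{v̄}(ξ, u) = D_u f(ξ, u, v̄(ξ, u))`. -/
theorem fvbar_C1_envelope
    (k m : ℕ) (hk : 1 ≤ k) (hm : 1 ≤ m)
    (C lam mu : ℝ) (hC : 0 < C) (hmu : 0 < mu) (hmulam : mu < lam)
    (f : ℝ × ℝ × ℝ × ℝ × ℝ → EVec k → EVec m → ℝ)
    (Du : ℝ × ℝ × ℝ × ℝ × ℝ → EVec k → EVec m → EVec k)
    (Dv : ℝ × ℝ × ℝ × ℝ × ℝ → EVec k → EVec m → EVec m)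
    (hf_cont : Continuous fun p : (ℝ × ℝ × ℝ × ℝ × ℝ) × EVec k × EVec m => f p.1 p.2.1 p.2.2)
    (hDu : ∀ ξ v u, HasGradientAt (fun u' => f ξ u' v) (Du ξ u v) u)
    (hDv : ∀ ξ u v, HasGradientAt (fun v' => f ξ u v') (Dv ξ u v) v)
    (hD_cont : ∀ ξ, Continuous fun p : EVec k × EVec m => (Du ξ p.1 p.2, Dv ξ p.1 p.2))
    (hAiu : ∀ ξ u u' v, ⟪Du ξ u v - Du ξ u' v, u - u'⟫ ≤ -lam * ‖u - u'‖ ^ 2)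
    (hAiv : ∀ ξ u v v', ⟪Dv ξ u v - Dv ξ u v', v - v'⟫ ≥ lam * ‖v - v'‖ ^ 2)
    (hAii1 : ∀ ξ, |f ξ 0 0| ≤ C)
    (hAii2 : ∀ ξ ξ' u v, |f ξ u v - f ξ' u v| ≤ C * ‖ξ - ξ'‖)
    (hAii3 : ∀ ξ ξ' u u' v v',
      ‖Du ξ u v - Du ξ' u' v'‖ ≤ C * (‖ξ - ξ'‖ + ‖u - u'‖) + mu * ‖v - v'‖)
    (hAii4 : ∀ ξ, ‖Du ξ 0 0‖ ≤ C)
    (hAii5 : ∀ (ξ ξ' : ℝ × ℝ × ℝ × ℝ × ℝ) u u' v v',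
      ‖Dv ξ u v - Dv ξ' u' v'‖ ≤
        C * (‖(ξ.1, ξ.2.1, ξ.2.2.1, ξ.2.2.2.1) - (ξ'.1, ξ'.2.1, ξ'.2.2.1, ξ'.2.2.2.1)‖ +
          ‖v - v'‖) + mu * ‖u - u'‖)
    (hAii6 : ∀ ξ, ‖Dv ξ 0 0‖ ≤ C)
    (vbar : ℝ × ℝ × ℝ × ℝ → EVec k → EVec m)
    (hvbar : ∀ (ξ : ℝ × ℝ × ℝ × ℝ) (u : EVec k) (v : EVec m),
      f (ξ.1, ξ.2.1, ξ.2.2.1, ξ.2.2.2, 0) u (vbar ξ u) ≤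
        f (ξ.1, ξ.2.1, ξ.2.2.1, ξ.2.2.2, 0) u v)
    :
    ∀ ξ : ℝ × ℝ × ℝ × ℝ,
      (∀ u, HasGradientAt
        (fun u' => f (ξ.1, ξ.2.1, ξ.2.2.1, ξ.2.2.2, 0) u' (vbar ξ u'))
        (Du (ξ.1, ξ.2.1, ξ.2.2.1, ξ.2.2.2, 0) u (vbar ξ u)) u) ∧
      Continuous fun u => Du (ξ.1, ξ.2.1, ξ.2.2.1, ξ.2.2.2, 0) u (vbar ξ u) := by
  intro ξ
  set ζ : ℝ × ℝ × ℝ × ℝ × ℝ := (ξ.1, ξ.2.1, ξ.2.2.1, ξ.2.2.2, 0)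
  have hlam : 0 < lam := hmu.trans hmulam
  have hzero (u) : Dv ζ u (vbar ξ u) = 0 :=
    (hDv ζ u (vbar ξ u)).eq_zero_of_forall_le (hvbar ξ u)
  have hlip (u u') : ‖vbar ξ u - vbar ξ u'‖ ≤ ‖u - u'‖ := by
    have h := mul_norm_sub_le_of_strongly_monotone_zero (fun u v v' => hAiv ζ u v v')
      (mu := mu) (fun u u' v => by simpa using hAii5 ζ ζ u u' v v) hzero u u'
    have h' : mu * ‖u - u'‖ ≤ lam * ‖u - u'‖ := by gcongr
    exact le_of_mul_le_mul_left (h.trans h') hlam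
  have hcont : Continuous (vbar ξ) :=
    (LipschitzWith.of_dist_le_mul (K := 1) fun u u' => by
      simpa [dist_eq_norm] using hlip u u').continuous
  refine ⟨fun u => ?_, (hD_cont ζ).fst.comp (continuous_id.prodMk hcont)⟩
  have hexp (u' v) : |f ζ u' v - f ζ u v - ⟪Du ζ u (vbar ξ u), u' - u⟫| ≤
      (C * ‖u' - u‖ + mu * ‖v - vbar ξ u‖) * ‖u' - u‖ :=
    abs_sub_sub_inner_le_of_gradient_bound hC.le (hDu ζ v)
      (fun w => by simpa using hAii3 ζ ζ w u v (vbar ξ u))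
  refine hasGradientAt_of_abs_sub_sub_inner_le (K := C + mu) fun u' => ?_
  have hup := (abs_le.mp (hexp u' (vbar ξ u))).2
  have hlow := (abs_le.mp (hexp u' (vbar ξ u'))).1
  have hmin' := hvbar ξ u' (vbar ξ u)
  have hmin := hvbar ξ u (vbar ξ u')
  have hbd : (C * ‖u' - u‖ + mu * ‖vbar ξ u' - vbar ξ u‖) * ‖u' - u‖ ≤
      (C + mu) * ‖u' - u‖ ^ 2 := by
    calc _ ≤ (C * ‖u' - u‖ + mu * ‖u' - u‖) * ‖u' - u‖ := by gcongr; exact hlip u' u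
      _ = _ := by ring
  have hsq : 0 ≤ mu * ‖u' - u‖ ^ 2 := by positivity
  simp only [sub_self, norm_zero, mul_zero, add_zero] at hup
  rw [abs_le]
  constructor <;> linarith
end
end

section
/- For every ξ = (x₀,y,z₀) ∈ ℝ³, the function u ↦ H̄(ξ,u) is continuously differentiable on U with D_u H̄(ξ,u) = ∫_ℝ D_u f(x₀,x₁,y,z₀,0,u,v̄(x₀,x₁,y,z₀,u)) ν(dx₁) + (∫_ℝ b₀(x₀,x₁,z₀) ν(dx₁)) z₀, and it satisfies the strong monotonicity estimate ⟨D_u H̄(ξ,u) − D_u H̄(ξ,u'), u − u'⟩ ≤ −((λ² − μ²)/λ) |u − u'|² for all u, u' ∈ U. -/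
open scoped RealInnerProductSpace BigOperators
open MeasureTheory

noncomputable section

/-- The limit Hamiltonian `H̄(ξ, u)`, `ξ = (x₀, y, z₀)`, defined through the
probability measure `ν` (the conditional law of `X̄¹_s`). -/
def Hbar {k m : ℕ} (f : ℝ × ℝ × ℝ × ℝ × ℝ → EVec k → EVec m → ℝ)
    (b0 : ℝ → ℝ → ℝ → EVec k) (vbar : ℝ × ℝ × ℝ × ℝ → EVec k → EVec m)
    (ν : Measure ℝ) (x0 y z0 : ℝ) (u : EVec k) : ℝ :=
  (∫ x1, f (x0, x1, y, z0, 0) u (vbar (x0, x1, y, z0) u) ∂ν)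
    + ⟪∫ x1, b0 x0 x1 z0 ∂ν, u⟫ * z0

/-- The gradient of the limit Hamiltonian `H̄` in `u`, `ξ = (x₀, y, z₀)`. -/
def Gbar {k m : ℕ} (Du : ℝ × ℝ × ℝ × ℝ × ℝ → EVec k → EVec m → EVec k)
    (b0 : ℝ → ℝ → ℝ → EVec k) (vbar : ℝ × ℝ × ℝ × ℝ → EVec k → EVec m)
    (ν : Measure ℝ) (x0 y z0 : ℝ) (u : EVec k) : EVec k :=
  (∫ x1, Du (x0, x1, y, z0, 0) u (vbar (x0, x1, y, z0) u) ∂ν) + z0 • ∫ x1, b0 x0 x1 z0 ∂ν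

section GradientTools

variable {E : Type*} [NormedAddCommGroup E] [InnerProductSpace ℝ E]

/-- Mean value inequality: the error of a linear approximation with slope `p` is controlled by
the distance from the gradient to `p`. -/
lemma abs_sub_sub_inner_le_of_norm_gradient_sub_le [CompleteSpace E]
    {g : E → ℝ} {g' : E → E}
    (hg : ∀ z, HasGradientAt g (g' z) z) {u w p : E} {K : ℝ}
    (hK : ∀ z ∈ segment ℝ u w, ‖g' z - p‖ ≤ K) :
    |g w - g u - ⟪p, w - u⟫| ≤ K * ‖w - u‖ := by
  have h := (convex_segment u w).norm_image_sub_le_of_norm_hasFDerivWithin_le'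
    (f := g) (f' := fun z => InnerProductSpace.toDual ℝ E (g' z))
    (φ := InnerProductSpace.toDual ℝ E p) (C := K)
    (fun z _ => (hg z).hasFDerivAt.hasFDerivWithinAt)
    (fun z hz => by rw [← map_sub, LinearIsometryEquiv.norm_map]; exact hK z hz)
    (left_mem_segment ℝ u w) (right_mem_segment ℝ u w)
  simpa [Real.norm_eq_abs] using h

lemma norm_sub_left_le_of_mem_segment {u w z : E} (hz : z ∈ segment ℝ u w) :
    ‖z - u‖ ≤ ‖w - u‖ := by
  obtain ⟨t, ⟨ht0, ht1⟩, rfl⟩ := (segment_eq_image' ℝ u w).subset hz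
  rw [add_sub_cancel_left, norm_smul, Real.norm_of_nonneg ht0]
  exact mul_le_of_le_one_left (norm_nonneg _) ht1

lemma hasGradientAt_of_abs_sub_sub_inner_le_sq [CompleteSpace E]
    {g : E → ℝ} {p u : E} {L : ℝ}
    (h : ∀ w, |g w - g u - ⟪p, w - u⟫| ≤ L * ‖w - u‖ ^ 2) : HasGradientAt g p u := by
  rw [hasGradientAt_iff_isLittleO]
  refine Asymptotics.IsBigO.trans_isLittleO (g := fun w => ‖w - u‖ ^ 2)
    (Asymptotics.IsBigO.of_bound L (Filter.Eventually.of_forall fun w => ?_)) ?_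
  · simpa [Real.norm_eq_abs] using h w
  · exact Asymptotics.isLittleO_pow_sub_sub u one_lt_two

lemma eq_zero_of_hasGradientAt_of_forall_le [CompleteSpace E] {g : E → ℝ} {p v : E}
    (hg : HasGradientAt g p v) (hmin : ∀ w, g v ≤ g w) : p = 0 := by
  have h : IsLocalMin g v := Filter.Eventually.of_forall hmin
  simpa using h.hasFDerivAt_eq_zero hg.hasFDerivAt

/-- Distance to a zero of a strongly monotone map. -/
lemma mul_norm_sub_le_of_strongly_monotone {G : E → E} {lam : ℝ}
    (hG : ∀ v v', lam * ‖v - v'‖ ^ 2 ≤ ⟪G v - G v', v - v'⟫) {v : E} (hv : G v = 0) (v' : E) :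
    lam * ‖v - v'‖ ≤ ‖G v'‖ := by
  rcases (norm_nonneg (v - v')).eq_or_lt with h0 | hpos
  · rw [← h0, mul_zero]; exact norm_nonneg _
  · refine le_of_mul_le_mul_right ?_ hpos
    have h1 := hG v v'
    have h2 := real_inner_le_norm (G v - G v') (v - v')
    rw [hv, zero_sub, norm_neg] at h2
    rw [hv, zero_sub] at h1
    nlinarith

end GradientTools

section ParametricIntegral

variable {E : Type*} [NormedAddCommGroup E] [InnerProductSpace ℝ E]
  {α : Type*} [MeasurableSpace α] {ν : Measure α} [IsProbabilityMeasure ν]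

lemma abs_integral_sub_sub_inner_le_sq [CompleteSpace E] {φ : α → E → ℝ} {ψ : α → E → E} {L : ℝ}
    (hφ : ∀ u, Integrable (fun x => φ x u) ν) (hψ : ∀ u, Integrable (fun x => ψ x u) ν) {u w : E}
    (h : ∀ x, |φ x w - φ x u - ⟪ψ x u, w - u⟫| ≤ L * ‖w - u‖ ^ 2) :
    |(∫ x, φ x w ∂ν) - (∫ x, φ x u ∂ν) - ⟪∫ x, ψ x u ∂ν, w - u⟫| ≤ L * ‖w - u‖ ^ 2 := by
  have hin : ∫ x, ⟪ψ x u, w - u⟫ ∂ν = ⟪∫ x, ψ x u ∂ν, w - u⟫ := by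
    simp_rw [real_inner_comm (w - u)]
    exact integral_inner (hψ u) _
  have hint : Integrable (fun x => ⟪ψ x u, w - u⟫) ν := (hψ u).inner_const _
  rw [← hin, ← integral_sub (hφ w) (hφ u),
    ← integral_sub (f := fun x => φ x w - φ x u) ((hφ w).sub (hφ u)) hint]
  simpa using norm_integral_le_of_norm_le_const (μ := ν)
    (f := fun x => φ x w - φ x u - ⟪ψ x u, w - u⟫) (Filter.Eventually.of_forall h)

lemma inner_integral_sub_le [CompleteSpace E] {ψ : α → E → E}
    (hψ : ∀ u, Integrable (fun x => ψ x u) ν)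
    {u u' : E} {K : ℝ} (h : ∀ x, ⟪ψ x u - ψ x u', u - u'⟫ ≤ K) :
    ⟪(∫ x, ψ x u ∂ν) - ∫ x, ψ x u' ∂ν, u - u'⟫ ≤ K := by
  have hsub : Integrable (fun x => ψ x u - ψ x u') ν := (hψ u).sub (hψ u')
  rw [← integral_sub (hψ u) (hψ u'), real_inner_comm, ← integral_inner hsub]
  calc ∫ x, ⟪u - u', ψ x u - ψ x u'⟫ ∂ν ≤ ∫ _, K ∂ν :=
        integral_mono (hsub.const_inner _) (integrable_const _)
          fun x => by simpa only [real_inner_comm] using h x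
    _ = K := by simp

lemma continuous_integral_of_uniform_lipschitz {ψ : α → E → E} {L : ℝ}
    (hψ : ∀ u, Integrable (fun x => ψ x u) ν)
    (h : ∀ x u u', ‖ψ x u - ψ x u'‖ ≤ L * ‖u - u'‖) :
    Continuous fun u => ∫ x, ψ x u ∂ν := by
  refine (LipschitzWith.of_dist_le' (K := L) fun u u' => ?_).continuous
  rw [dist_eq_norm, dist_eq_norm, ← integral_sub (hψ u) (hψ u')]
  simpa using norm_integral_le_of_norm_le_const (μ := ν)
    (Filter.Eventually.of_forall fun x => h x u u')

end ParametricIntegral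

section Envelope

variable {E F : Type*} [NormedAddCommGroup E] [InnerProductSpace ℝ E] [CompleteSpace E]
  {f : E → F → ℝ} {Du : E → F → E}

/-- Quantitative envelope theorem: a Lipschitz minimizing selection gives a first-order expansion
of the minimal value with quadratic remainder. -/
lemma abs_envelope_sub_sub_inner_le_sq [NormedAddCommGroup F] {C mu K : ℝ}
    (hC : 0 ≤ C) (hmu : 0 ≤ mu) (hK : 0 ≤ K)
    (hDu : ∀ u v, HasGradientAt (fun u' => f u' v) (Du u v) u)
    (hlip : ∀ u u' v v', ‖Du u v - Du u' v'‖ ≤ C * ‖u - u'‖ + mu * ‖v - v'‖)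
    {s : E → F} (hs : ∀ u v, f u (s u) ≤ f u v)
    (hslip : ∀ u u', ‖s u - s u'‖ ≤ K * ‖u - u'‖) (u w : E) :
    |f w (s w) - f u (s u) - ⟪Du u (s u), w - u⟫| ≤ (C + mu * K) * ‖w - u‖ ^ 2 := by
  have key : ∀ v, ‖v - s u‖ ≤ K * ‖w - u‖ →
      |f w v - f u v - ⟪Du u (s u), w - u⟫| ≤ (C + mu * K) * ‖w - u‖ ^ 2 := by
    intro v hv
    calc |f w v - f u v - ⟪Du u (s u), w - u⟫|
        ≤ ((C + mu * K) * ‖w - u‖) * ‖w - u‖ :=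
          abs_sub_sub_inner_le_of_norm_gradient_sub_le (g := fun z => f z v)
            (fun z => hDu z v) fun z hz =>
            calc ‖Du z v - Du u (s u)‖ ≤ C * ‖z - u‖ + mu * ‖v - s u‖ := hlip _ _ _ _
              _ ≤ C * ‖w - u‖ + mu * (K * ‖w - u‖) := by
                gcongr; exact norm_sub_left_le_of_mem_segment hz
              _ = (C + mu * K) * ‖w - u‖ := by ring
      _ = (C + mu * K) * ‖w - u‖ ^ 2 := by ring
  have h1 := abs_le.1 (key (s u) (by simpa using by positivity))
  have h2 := abs_le.1 (key (s w) (hslip w u))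
  have h3 := hs w (s u)
  have h4 := hs u (s w)
  exact abs_le.2 ⟨by linarith, by linarith⟩

end Envelope

/-- `H̄(ξ, ·)` is continuously differentiable with gradient (4.57-1), and it
satisfies the strong monotonicity estimate (4.57). -/
theorem Hbar_C1_and_strong_concavity
    (k m : ℕ) (hk : 1 ≤ k) (hm : 1 ≤ m)
    (C lam mu : ℝ) (hC : 0 < C) (hmu : 0 < mu) (hmulam : mu < lam)
    (f : ℝ × ℝ × ℝ × ℝ × ℝ → EVec k → EVec m → ℝ)
    (Du : ℝ × ℝ × ℝ × ℝ × ℝ → EVec k → EVec m → EVec k)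
    (Dv : ℝ × ℝ × ℝ × ℝ × ℝ → EVec k → EVec m → EVec m)
    (hf_cont : Continuous fun p : (ℝ × ℝ × ℝ × ℝ × ℝ) × EVec k × EVec m => f p.1 p.2.1 p.2.2)
    (hDu : ∀ ξ v u, HasGradientAt (fun u' => f ξ u' v) (Du ξ u v) u)
    (hDv : ∀ ξ u v, HasGradientAt (fun v' => f ξ u v') (Dv ξ u v) v)
    (hD_cont : ∀ ξ, Continuous fun p : EVec k × EVec m => (Du ξ p.1 p.2, Dv ξ p.1 p.2))
    (hAiu : ∀ ξ u u' v, ⟪Du ξ u v - Du ξ u' v, u - u'⟫ ≤ -lam * ‖u - u'‖ ^ 2)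
    (hAiv : ∀ ξ u v v', ⟪Dv ξ u v - Dv ξ u v', v - v'⟫ ≥ lam * ‖v - v'‖ ^ 2)
    (hAii1 : ∀ ξ, |f ξ 0 0| ≤ C)
    (hAii2 : ∀ ξ ξ' u v, |f ξ u v - f ξ' u v| ≤ C * ‖ξ - ξ'‖)
    (hAii3 : ∀ ξ ξ' u u' v v',
      ‖Du ξ u v - Du ξ' u' v'‖ ≤ C * (‖ξ - ξ'‖ + ‖u - u'‖) + mu * ‖v - v'‖)
    (hAii4 : ∀ ξ, ‖Du ξ 0 0‖ ≤ C)
    (hAii5 : ∀ (ξ ξ' : ℝ × ℝ × ℝ × ℝ × ℝ) u u' v v',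
      ‖Dv ξ u v - Dv ξ' u' v'‖ ≤
        C * (‖(ξ.1, ξ.2.1, ξ.2.2.1, ξ.2.2.2.1) - (ξ'.1, ξ'.2.1, ξ'.2.2.1, ξ'.2.2.2.1)‖ +
          ‖v - v'‖) + mu * ‖u - u'‖)
    (hAii6 : ∀ ξ, ‖Dv ξ 0 0‖ ≤ C)
    (b0 : ℝ → ℝ → ℝ → EVec k)
    (Cb : ℝ) (hCbpos : 0 < Cb)
    (hb0cont : Continuous fun p : ℝ × ℝ × ℝ => b0 p.1 p.2.1 p.2.2)
    (hb0bdd : ∀ x0 x1 z, ‖b0 x0 x1 z‖ ≤ Cb)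
    (hb0zbdd : ∀ x0 x1 z, ‖z • b0 x0 x1 z‖ ≤ Cb)
    (hb0zlip : ∀ x0 x1 z x0' x1' z',
      ‖z • b0 x0 x1 z - z' • b0 x0' x1' z'‖ ≤ Cb * (|x0 - x0'| + |x1 - x1'| + |z - z'|))
    (vbar : ℝ × ℝ × ℝ × ℝ → EVec k → EVec m)
    (hvbar : ∀ (ξ : ℝ × ℝ × ℝ × ℝ) (u : EVec k) (v : EVec m),
      f (ξ.1, ξ.2.1, ξ.2.2.1, ξ.2.2.2, 0) u (vbar ξ u) ≤
        f (ξ.1, ξ.2.1, ξ.2.2.1, ξ.2.2.2, 0) u v)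
    (ν : Measure ℝ) [IsProbabilityMeasure ν] :
    ∀ x0 y z0 : ℝ,
      (∀ u, HasGradientAt (fun u' => Hbar f b0 vbar ν x0 y z0 u')
        (Gbar Du b0 vbar ν x0 y z0 u) u) ∧
      Continuous (fun u => Gbar Du b0 vbar ν x0 y z0 u) ∧
      ∀ u u' : EVec k,
        ⟪Gbar Du b0 vbar ν x0 y z0 u - Gbar Du b0 vbar ν x0 y z0 u', u - u'⟫ ≤
          -((lam ^ 2 - mu ^ 2) / lam) * ‖u - u'‖ ^ 2 := by
  intro x0 y z0
  have hlam : 0 < lam := hmu.trans hmulam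
  set e : ℝ → ℝ × ℝ × ℝ × ℝ × ℝ := fun x1 => (x0, x1, y, z0, 0) with he
  set V : ℝ → EVec k → EVec m := fun x1 u => vbar (x0, x1, y, z0) u with hV
  have hmin : ∀ x1 u v, f (e x1) u (V x1 u) ≤ f (e x1) u v :=
    fun x1 u v => hvbar (x0, x1, y, z0) u v
  have hzero : ∀ x1 u, Dv (e x1) u (V x1 u) = 0 := fun x1 u =>
    eq_zero_of_hasGradientAt_of_forall_le (hDv (e x1) u (V x1 u)) (hmin x1 u)
  have hdist : ∀ x1 u v, lam * ‖V x1 u - v‖ ≤ ‖Dv (e x1) u v‖ := fun x1 u v =>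
    mul_norm_sub_le_of_strongly_monotone (hAiv (e x1) u) (hzero x1 u) v
  have hVlip : ∀ x1 x1' u u',
      ‖V x1 u - V x1' u'‖ ≤ C / lam * |x1 - x1'| + mu / lam * ‖u - u'‖ := by
    intro x1 x1' u u'
    have h1 := hdist x1 u (V x1' u')
    have h2 := hAii5 (e x1) (e x1') u u' (V x1' u') (V x1' u')
    rw [hzero x1' u', sub_zero] at h2
    simp only [he, sub_self, norm_zero, add_zero, Prod.mk_sub_mk, Prod.norm_mk,
      Real.norm_eq_abs] at h1 h2
    simp only [abs_nonneg, sup_of_le_left, sup_of_le_right] at h2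
    rw [div_mul_eq_mul_div, div_mul_eq_mul_div, ← add_div, le_div_iff₀ hlam]
    linarith
  have hVlip_u : ∀ x1 u u', ‖V x1 u - V x1 u'‖ ≤ mu / lam * ‖u - u'‖ := fun x1 u u' => by
    simpa using hVlip x1 x1 u u'
  have hVbdd : ∀ x1 u, ‖V x1 u‖ ≤ (C + mu * ‖u‖) / lam := by
    intro x1 u
    have h1 := hdist x1 u 0
    have h2 := hAii5 (e x1) (e x1) u 0 0 0
    simp only [sub_self, sub_zero, norm_zero, add_zero, mul_zero, zero_add] at h1 h2
    have h3 := norm_le_norm_add_norm_sub' (Dv (e x1) u 0) (Dv (e x1) 0 0)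
    rw [le_div_iff₀ hlam]
    linarith [hAii6 (e x1)]
  have he_cont : Continuous e := by fun_prop
  have hVcont : ∀ u, Continuous fun x1 => V x1 u := fun u =>
    (LipschitzWith.of_dist_le' (K := C / lam) fun x1 x1' => by
      simpa [dist_eq_norm] using hVlip x1 x1' u u).continuous
  have hGlip : ∀ x1 u u', ‖Du (e x1) u (V x1 u) - Du (e x1) u' (V x1 u')‖ ≤
      (C + mu * (mu / lam)) * ‖u - u'‖ := by
    intro x1 u u'
    have h := hAii3 (e x1) (e x1) u u' (V x1 u) (V x1 u')
    rw [sub_self, norm_zero, zero_add] at h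
    have := mul_le_mul_of_nonneg_left (hVlip_u x1 u u') hmu.le
    linarith
  have hDu_norm : ∀ ξ u v, ‖Du ξ u v‖ ≤ C + C * ‖u‖ + mu * ‖v‖ := by
    intro ξ u v
    have h := hAii3 ξ ξ u 0 v 0
    simp only [sub_self, sub_zero, norm_zero, zero_add] at h
    linarith [hAii4 ξ, norm_le_norm_add_norm_sub' (Du ξ u v) (Du ξ 0 0)]
  have hDv_norm : ∀ ξ u v, ‖Dv ξ u v‖ ≤ C + C * ‖v‖ + mu * ‖u‖ := by
    intro ξ u v
    have h := hAii5 ξ ξ u 0 v 0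
    simp only [sub_self, sub_zero, norm_zero, zero_add] at h
    linarith [hAii6 ξ, norm_le_norm_add_norm_sub' (Dv ξ u v) (Dv ξ 0 0)]
  have hDucont : Continuous fun p : (ℝ × ℝ × ℝ × ℝ × ℝ) × EVec k × EVec m =>
      Du p.1 p.2.1 p.2.2 := by
    refine continuous_iff_continuousAt.2 fun q => tendsto_iff_norm_sub_tendsto_zero.2 ?_
    refine squeeze_zero (fun _ => norm_nonneg _) (fun p => hAii3 p.1 q.1 p.2.1 q.2.1 p.2.2 q.2.2) ?_
    refine Continuous.tendsto' (by fun_prop) _ _ (by simp)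
  have hGint : ∀ u, Integrable (fun x1 => Du (e x1) u (V x1 u)) ν := by
    intro u
    refine Integrable.of_bound (C := C + C * ‖u‖ + mu * ((C + mu * ‖u‖) / lam))
      (hDucont.comp (he_cont.prodMk
        (continuous_const.prodMk (hVcont u)))).aestronglyMeasurable
      (Filter.Eventually.of_forall fun x1 => (hDu_norm _ _ _).trans ?_)
    gcongr
    exact hVbdd x1 u
  have hFint : ∀ u, Integrable (fun x1 => f (e x1) u (V x1 u)) ν := by
    intro u
    set R := (C + mu * ‖u‖) / lam with hR
    refine Integrable.of_bound
      (C := C + (C + C * ‖u‖) * ‖u‖ + (C + C * R + mu * ‖u‖) * R)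
      (hf_cont.comp (he_cont.prodMk
        (continuous_const.prodMk (hVcont u)))).aestronglyMeasurable
      (Filter.Eventually.of_forall fun x1 => ?_)
    have h1 : |f (e x1) u 0 - f (e x1) 0 0| ≤ (C + C * ‖u‖) * ‖u‖ := by
      have := abs_sub_sub_inner_le_of_norm_gradient_sub_le (g := fun u' => f (e x1) u' 0)
        (fun z => hDu (e x1) 0 z) (u := 0) (w := u) (p := 0) (K := C + C * ‖u‖)
        fun z hz => by
          have h := norm_sub_left_le_of_mem_segment hz
          have h' := hDu_norm (e x1) z 0
          simp only [sub_zero, norm_zero, mul_zero, add_zero] at h h' ⊢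
          exact h'.trans (by gcongr)
      simpa using this
    have h2 : |f (e x1) u (V x1 u) - f (e x1) u 0| ≤ (C + C * R + mu * ‖u‖) * R := by
      have := abs_sub_sub_inner_le_of_norm_gradient_sub_le (g := fun v => f (e x1) u v)
        (fun z => hDv (e x1) u z) (u := 0) (w := V x1 u) (p := 0) (K := C + C * R + mu * ‖u‖)
        fun z hz => by
          have h := norm_sub_left_le_of_mem_segment hz
          simp only [sub_zero] at h ⊢
          refine (hDv_norm (e x1) u z).trans ?_
          gcongr
          exact h.trans (hVbdd x1 u)
      simp only [inner_zero_left, sub_zero] at this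
      refine this.trans ?_
      gcongr
      exact hVbdd x1 u
    have h3 := hAii1 (e x1)
    rw [Real.norm_eq_abs]
    rw [abs_le] at h1 h2 h3 ⊢
    constructor <;> linarith
  refine ⟨fun u => ?_, ?_, fun u u' => ?_⟩
  · refine hasGradientAt_of_abs_sub_sub_inner_le_sq (L := C + mu * (mu / lam)) fun w => ?_
    have h := abs_integral_sub_sub_inner_le_sq (φ := fun x1 u => f (e x1) u (V x1 u))
      (ψ := fun x1 u => Du (e x1) u (V x1 u)) hFint hGint (u := u) (w := w) fun x1 =>
      abs_envelope_sub_sub_inner_le_sq hC.le hmu.le (by positivity)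
        (fun u v => hDu (e x1) v u)
        (fun u u' v v' => by simpa using hAii3 (e x1) (e x1) u u' v v')
        (hmin x1) (hVlip_u x1) u w
    convert h using 2
    simp only [Hbar, Gbar, inner_add_left, inner_sub_right, real_inner_smul_left, he, hV]
    ring
  · exact (continuous_integral_of_uniform_lipschitz hGint hGlip).add
      continuous_const
  · rw [Gbar, Gbar, add_sub_add_right_eq_sub]
    refine inner_integral_sub_le hGint fun x1 => ?_
    have h1 := hAiu (e x1) u u' (V x1 u)
    have h2 := hAii3 (e x1) (e x1) u' u' (V x1 u) (V x1 u')
    simp only [sub_self, norm_zero, add_zero, mul_zero, zero_add] at h2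
    have h3 : ⟪Du (e x1) u' (V x1 u) - Du (e x1) u' (V x1 u'), u - u'⟫ ≤
        mu * (mu / lam * ‖u - u'‖) * ‖u - u'‖ :=
      (real_inner_le_norm _ _).trans (by
        gcongr
        exact h2.trans (by gcongr; exact hVlip_u x1 u u'))
    calc ⟪Du (e x1) u (V x1 u) - Du (e x1) u' (V x1 u'), u - u'⟫
        = ⟪Du (e x1) u (V x1 u) - Du (e x1) u' (V x1 u), u - u'⟫ +
          ⟪Du (e x1) u' (V x1 u) - Du (e x1) u' (V x1 u'), u - u'⟫ := by
          rw [← inner_add_left, sub_add_sub_cancel]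
      _ ≤ -lam * ‖u - u'‖ ^ 2 + mu * (mu / lam * ‖u - u'‖) * ‖u - u'‖ := add_le_add h1 h3
      _ = -((lam ^ 2 - mu ^ 2) / lam) * ‖u - u'‖ ^ 2 := by field_simp; ring
end
end
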